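/- For any continuous map T of a compact metric space and sequences of integers A ⊆ B (A a subsequence of B), it is not necessarily true that h_A(T) ≤ h_B(T) is violated in general, but for the sequence entropy defined along a sequence A of integers, the subadditivity h_{A,μ}(T×S) ≤ h_{A,μ}(T) + h_{A,μ'}(S) holds for any two measure-preserving systems. -/

import Mathlib

open MeasureTheory Filter Set

noncomputable section

variable {X : Type*} [MeasurableSpace X]

/-- `ξ` is a finite measurable partition of `X` (mod 0) for the measure `μ`. -/
def IsPartition (μ : Measure X) (ξ : Finset (Set X)) : Prop :=
  (∀ C ∈ ξ, MeasurableSet C) ∧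
  (∀ C ∈ ξ, ∀ D ∈ ξ, C ≠ D → μ (C ∩ D) = 0) ∧
  μ ((⋃ C ∈ ξ, C)ᶜ) = 0

/-- The (Shannon) entropy `H(ξ) = -∑ μ(C) log μ(C)` of a finite partition. -/
def partEntropy (μ : Measure X) (ξ : Finset (Set X)) : ℝ :=
  -∑ C ∈ ξ, (μ C).toReal * Real.log (μ C).toReal

/-- The conditional entropy `H(ξ|η) = -∑_D μ(D) ∑_C μ(C|D) log μ(C|D)`. -/
def partCondEntropy (μ : Measure X) (ξ η : Finset (Set X)) : ℝ :=
  -∑ D ∈ η, ∑ C ∈ ξ, (μ (C ∩ D)).toReal * Real.log ((μ (C ∩ D)).toReal / (μ D).toReal)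

/-- The join `ξ ∨ η` of two partitions: the nonnull intersections `C ∩ D`. -/
def partJoin (μ : Measure X) (ξ η : Finset (Set X)) : Finset (Set X) :=
  letI := Classical.decEq (Set X)
  letI := Classical.decPred fun A : Set X => μ A ≠ 0
  ((ξ ×ˢ η).image fun p => p.1 ∩ p.2).filter fun A => μ A ≠ 0


/-- The join `⋁_{i=1}^n T^{-t_i} ξ` along the sequence `A` (nonnull atoms). -/
def seqPart (μ : Measure X) (T : Equiv.Perm X) (A : ℕ → ℤ) (ξ : Finset (Set X)) (n : ℕ) :
    Finset (Set X) :=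
  letI := Classical.decEq (Set X)
  letI := Classical.decPred fun B : Set X => μ B ≠ 0
  ((Fintype.piFinset fun _ : Fin n => ξ).image fun c =>
    ⋂ i : Fin n, ⇑(T ^ A (i : ℕ)) ⁻¹' c i).filter fun B => μ B ≠ 0

/-- The sequence entropy of `T` along `A` with respect to the partition `ξ`:
`h_A(T,ξ) = limsup_n (1/n) H(⋁_{i=1}^n T^{-t_i}ξ)`. -/
def seqEntPart (μ : Measure X) (T : Equiv.Perm X) (A : ℕ → ℤ) (ξ : Finset (Set X)) : ℝ :=
  limsup (fun n : ℕ => partEntropy μ (seqPart μ T A ξ n) / n) atTop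

/-- The measure-theoretic sequence entropy `h_{A,μ}(T) = sup_ξ h_A(T,ξ)`. -/
def seqEnt (μ : Measure X) (T : Equiv.Perm X) (A : ℕ → ℤ) : ℝ :=
  sSup {h | ∃ ξ : Finset (Set X), IsPartition μ ξ ∧ seqEntPart μ T A ξ = h}

namespace SeqEntAux

open Real

section Basic

set_option linter.unusedSectionVars false
set_option linter.unusedVariables false

variable {Ω : Type*} [MeasurableSpace Ω] {α β γ : Type*}
  [Fintype α] [MeasurableSpace α] [MeasurableSingletonClass α]
  [Fintype β] [MeasurableSpace β] [MeasurableSingletonClass β]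
  [Fintype γ] [MeasurableSpace γ] [MeasurableSingletonClass γ]

/-- Shannon entropy of a finite-valued random variable. -/
def ent {Ω : Type*} [MeasurableSpace Ω] {α : Type*} [Fintype α] (μ : Measure Ω) (f : Ω → α) : ℝ :=
  ∑ i, negMulLog (μ.real (f ⁻¹' {i}))

theorem ent_nonneg (μ : Measure Ω) [IsProbabilityMeasure μ] (f : Ω → α) : 0 ≤ ent μ f :=
  Finset.sum_nonneg fun _ _ => negMulLog_nonneg measureReal_nonneg measureReal_le_one

theorem ent_congr (μ : Measure Ω) {f g : Ω → α} (h : f =ᵐ[μ] g) : ent μ f = ent μ g := by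
  unfold ent
  refine Finset.sum_congr rfl fun i _ => ?_
  congr 1
  apply measureReal_congr
  filter_upwards [h] with x hx
  change (f x = i) = (g x = i)
  rw [hx]

theorem sum_real (μ : Measure Ω) [IsFiniteMeasure μ] {f : Ω → α} (hf : Measurable f) {s : Set Ω}
    (hs : MeasurableSet s) : ∑ i, μ.real (s ∩ f ⁻¹' {i}) = μ.real s := by
  have h := sum_measureReal_preimage_singleton (μ := μ.restrict s) (Finset.univ : Finset α) (f := f)
    (fun y _ => hf (measurableSet_singleton y))
  simp only [Finset.coe_univ, preimage_univ] at h
  rw [measureReal_restrict_apply_univ] at h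
  rw [← h]
  refine Finset.sum_congr rfl fun i _ => ?_
  rw [measureReal_restrict_apply (hf (measurableSet_singleton i)), inter_comm]

theorem sum_real_univ (μ : Measure Ω) [IsProbabilityMeasure μ] {f : Ω → α} (hf : Measurable f) :
    ∑ i, μ.real (f ⁻¹' {i}) = 1 := by
  simpa using sum_real μ hf MeasurableSet.univ

theorem ent_comp_le (μ : Measure Ω) [IsProbabilityMeasure μ] {f : Ω → α} (hf : Measurable f)
    {g : Ω → β} (hg : Measurable g)
    (h : ∃ φ : α → β, ∀ x, g x = φ (f x)) : ent μ g ≤ ent μ f := by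
  obtain ⟨φ, hφ⟩ := h
  classical
  unfold ent
  rw [← Finset.sum_fiberwise (s := Finset.univ) (g := φ) (f := fun i => negMulLog (μ.real (f ⁻¹' {i})))]
  refine Finset.sum_le_sum fun j _ => ?_
  have key : μ.real (g ⁻¹' {j}) = ∑ i ∈ Finset.univ.filter (fun i => φ i = j), μ.real (f ⁻¹' {i}) := by
    rw [← sum_real μ hf (hg (measurableSet_singleton j)), Finset.sum_filter]
    refine Finset.sum_congr rfl fun i _ => ?_
    split_ifs with hi
    · congr 1
      ext x
      simp only [mem_inter_iff, mem_preimage, mem_singleton_iff, hφ]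
      constructor
      · exact fun h => h.2
      · intro h; exact ⟨by rw [h, hi], h⟩
    · have : g ⁻¹' {j} ∩ f ⁻¹' {i} = ∅ := by
        ext x
        simp only [mem_inter_iff, mem_preimage, mem_singleton_iff, hφ, mem_empty_iff_false, iff_false]
        rintro ⟨h1, h2⟩
        exact hi (h2 ▸ h1)
      simp [this]
  have e : negMulLog (μ.real (g ⁻¹' {j})) =
      ∑ i ∈ Finset.univ.filter (fun i => φ i = j), -(μ.real (f ⁻¹' {i}) * log (μ.real (g ⁻¹' {j}))) := by
    rw [Finset.sum_neg_distrib, ← Finset.sum_mul, ← key, negMulLog_eq_neg]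
  rw [e]
  refine Finset.sum_le_sum fun i hi => ?_
  rw [negMulLog_eq_neg]
  simp only [neg_le_neg_iff]
  rcases (measureReal_nonneg (μ := μ) (s := f ⁻¹' {i})).eq_or_lt with h0 | h0
  · simp [← h0]
  · refine mul_le_mul_of_nonneg_left (log_le_log h0 ?_) h0.le
    rw [key]
    exact Finset.single_le_sum (f := fun i => μ.real (f ⁻¹' {i})) (fun _ _ => measureReal_nonneg) hi

theorem ent_eq_of (μ : Measure Ω) [IsProbabilityMeasure μ] {f : Ω → α} (hf : Measurable f)
    {g : Ω → β} (hg : Measurable g)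
    (h : ∃ φ : α → β, ∀ x, g x = φ (f x)) (h' : ∃ φ : β → α, ∀ x, f x = φ (g x)) :
    ent μ g = ent μ f :=
  le_antisymm (ent_comp_le μ hf hg h) (ent_comp_le μ hg hf h')

theorem term_ineq {p a b c : ℝ} (hp : 0 ≤ p) (ha : p ≤ a) (hb : p ≤ b) (hc : p ≤ c) :
    p - a * b / c ≤ p * log p + p * log c - p * log a - p * log b := by
  rcases hp.eq_or_lt with h0 | h0
  · subst h0
    have : 0 ≤ a * b / c := by positivity
    simpa using this
  · have ha' := h0.trans_le ha
    have hb' := h0.trans_le hb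
    have hc' := h0.trans_le hc
    have h1 := log_le_sub_one_of_pos (x := a * b / (c * p)) (by positivity)
    rw [log_div (by positivity) (by positivity), log_mul ha'.ne' hb'.ne',
      log_mul hc'.ne' h0.ne'] at h1
    have h2 := mul_le_mul_of_nonneg_left h1 h0.le
    have h3 : p * (a * b / (c * p) - 1) = a * b / c - p := by field_simp
    rw [h3] at h2
    linarith

theorem ent_submod (μ : Measure Ω) [IsProbabilityMeasure μ] {f : Ω → α} (hf : Measurable f)
    {g : Ω → β} (hg : Measurable g) {k : Ω → γ} (hk : Measurable k) :
    ent μ (fun x => (f x, g x, k x)) + ent μ k ≤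
      ent μ (fun x => (f x, k x)) + ent μ (fun x => (g x, k x)) := by
  set P : α → β → γ → ℝ := fun a b c => μ.real (f ⁻¹' {a} ∩ g ⁻¹' {b} ∩ k ⁻¹' {c}) with hP
  set A : α → γ → ℝ := fun a c => μ.real (f ⁻¹' {a} ∩ k ⁻¹' {c}) with hA
  set B : β → γ → ℝ := fun b c => μ.real (g ⁻¹' {b} ∩ k ⁻¹' {c}) with hB
  set C : γ → ℝ := fun c => μ.real (k ⁻¹' {c}) with hC
  have mf : ∀ a, MeasurableSet (f ⁻¹' {a}) := fun a => hf (measurableSet_singleton a)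
  have mg : ∀ a, MeasurableSet (g ⁻¹' {a}) := fun a => hg (measurableSet_singleton a)
  have mk : ∀ a, MeasurableSet (k ⁻¹' {a}) := fun a => hk (measurableSet_singleton a)
  have sA : ∀ a c, ∑ b, P a b c = A a c := by
    intro a c
    rw [hA]; dsimp only
    rw [← sum_real μ hg ((mf a).inter (mk c))]
    refine Finset.sum_congr rfl fun b _ => ?_
    simp only [hP]; congr 1; ext; simp; tauto
  have sB : ∀ b c, ∑ a, P a b c = B b c := by
    intro b c
    rw [hB]; dsimp only
    rw [← sum_real μ hf ((mg b).inter (mk c))]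
    refine Finset.sum_congr rfl fun b _ => ?_
    simp only [hP]; congr 1; ext; simp; tauto
  have sAC : ∀ c, ∑ a, A a c = C c := by
    intro c
    rw [hC]; dsimp only
    rw [← sum_real μ hf (mk c)]
    refine Finset.sum_congr rfl fun b _ => ?_
    simp only [hA]; congr 1; ext; simp; tauto
  have sBC : ∀ c, ∑ b, B b c = C c := by
    intro c
    rw [hC]; dsimp only
    rw [← sum_real μ hg (mk c)]
    refine Finset.sum_congr rfl fun b _ => ?_
    simp only [hB]; congr 1; ext; simp; tauto
  have e1 : ent μ (fun x => (f x, g x, k x)) = -∑ c, ∑ a, ∑ b, P a b c * log (P a b c) := by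
    unfold ent
    rw [Fintype.sum_prod_type]
    simp only [Fintype.sum_prod_type, negMulLog_eq_neg, Finset.sum_neg_distrib]
    congr 1
    conv_rhs => rw [Finset.sum_comm]
    refine Finset.sum_congr rfl fun a _ => ?_
    rw [Finset.sum_comm]
    refine Finset.sum_congr rfl fun c _ => ?_
    refine Finset.sum_congr rfl fun b _ => ?_
    have : (fun x => (f x, g x, k x)) ⁻¹' {(a, b, c)} = f ⁻¹' {a} ∩ g ⁻¹' {b} ∩ k ⁻¹' {c} := by
      ext; simp; tauto
    rw [this]
  have e2 : ent μ (fun x => (f x, k x)) = -∑ c, ∑ a, ∑ b, P a b c * log (A a c) := by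
    unfold ent
    simp only [Fintype.sum_prod_type, negMulLog_eq_neg, Finset.sum_neg_distrib]
    congr 1
    rw [Finset.sum_comm]
    refine Finset.sum_congr rfl fun c _ => ?_
    refine Finset.sum_congr rfl fun a _ => ?_
    rw [← Finset.sum_mul, sA]
    have : (fun x => (f x, k x)) ⁻¹' {(a, c)} = f ⁻¹' {a} ∩ k ⁻¹' {c} := by
      ext; simp
    rw [this]
  have e3 : ent μ (fun x => (g x, k x)) = -∑ c, ∑ a, ∑ b, P a b c * log (B b c) := by
    unfold ent
    simp only [Fintype.sum_prod_type, negMulLog_eq_neg, Finset.sum_neg_distrib]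
    congr 1
    rw [Finset.sum_comm]
    refine Finset.sum_congr rfl fun c _ => ?_
    rw [Finset.sum_comm]
    refine Finset.sum_congr rfl fun b _ => ?_
    rw [← Finset.sum_mul, sB]
    have : (fun x => (g x, k x)) ⁻¹' {(b, c)} = g ⁻¹' {b} ∩ k ⁻¹' {c} := by
      ext; simp
    rw [this]
  have e4 : ent μ k = -∑ c, ∑ a, ∑ b, P a b c * log (C c) := by
    unfold ent
    simp only [negMulLog_eq_neg, Finset.sum_neg_distrib]
    congr 1
    refine Finset.sum_congr rfl fun c _ => ?_
    simp only [← Finset.sum_mul, sA, sAC]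
    rfl
  have t : ∑ c, ∑ a, ∑ b, (P a b c - A a c * B b c / C c) ≤
      ∑ c, ∑ a, ∑ b, (P a b c * log (P a b c) + P a b c * log (C c) - P a b c * log (A a c)
        - P a b c * log (B b c)) := by
    refine Finset.sum_le_sum fun c _ => Finset.sum_le_sum fun a _ => Finset.sum_le_sum fun b _ => ?_
    refine term_ineq measureReal_nonneg ?_ ?_ ?_
    · exact measureReal_mono (by intro x; simp; tauto)
    · exact measureReal_mono (by intro x; simp; tauto)
    · exact measureReal_mono (by intro x; simp)
  have t0 : ∑ c, ∑ a, ∑ b, (P a b c - A a c * B b c / C c) = 0 := by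
    refine Finset.sum_eq_zero fun c _ => ?_
    simp only [Finset.sum_sub_distrib, sA, sAC, ← Finset.sum_div, ← Finset.mul_sum, sBC, ← Finset.sum_mul]
    rcases eq_or_ne (C c) 0 with h | h
    · simp [h]
    · field_simp; simp
  rw [t0] at t
  simp only [Finset.sum_sub_distrib, Finset.sum_add_distrib] at t
  rw [e1, e2, e3, e4]
  linarith

theorem ent_const (μ : Measure Ω) [IsProbabilityMeasure μ] [Unique α] (f : Ω → α) :
    ent μ f = 0 := by
  unfold ent
  rw [Fintype.sum_unique]
  have : f ⁻¹' {default} = univ := by ext x; simp [Subsingleton.elim (f x) default]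
  simp [this]

theorem ent_pair_le (μ : Measure Ω) [IsProbabilityMeasure μ] {f : Ω → α} (hf : Measurable f)
    {g : Ω → β} (hg : Measurable g) :
    ent μ (fun x => (f x, g x)) ≤ ent μ f + ent μ g := by
  have hk : Measurable (fun _ : Ω => ()) := measurable_const
  have h := ent_submod μ hf hg hk
  have h1 : ent μ (fun _ : Ω => ()) = 0 := ent_const μ _
  have h2 : ent μ (fun x => (f x, ())) ≤ ent μ f :=
    ent_comp_le μ hf (hf.prodMk hk) ⟨fun a => (a, ()), fun _ => rfl⟩
  have h3 : ent μ (fun x => (g x, ())) ≤ ent μ g :=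
    ent_comp_le μ hg (hg.prodMk hk) ⟨fun a => (a, ()), fun _ => rfl⟩
  have h4 : ent μ (fun x => (f x, g x)) ≤ ent μ (fun x => (f x, g x, ())) :=
    ent_comp_le μ (hf.prodMk (hg.prodMk hk)) (hf.prodMk hg) ⟨fun a => (a.1, a.2.1), fun _ => rfl⟩
  linarith

theorem ent_mp {Ω' : Type*} [MeasurableSpace Ω'] (μ : Measure Ω') {ν : Measure Ω} {S : Ω' → Ω}
    (hS : MeasurePreserving S μ ν) {f : Ω → α}
    (hf : Measurable f) : ent μ (fun x => f (S x)) = ent ν f := by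
  unfold ent
  refine Finset.sum_congr rfl fun i _ => ?_
  congr 1
  exact hS.measureReal_preimage (hf (measurableSet_singleton i)).nullMeasurableSet

/-- Joint process along a family of maps. -/
def joint {Ω α : Type*} (S : ℕ → Ω → Ω) (f : Ω → α) (n : ℕ) : Ω → (Fin n → α) :=
  fun x i => f (S i x)


theorem joint_meas {S : ℕ → Ω → Ω} (hS : ∀ n, Measurable (S n)) {f : Ω → α} (hf : Measurable f)
    (n : ℕ) : Measurable (joint S f n) :=
  measurable_pi_lambda _ fun i => hf.comp (hS i)

theorem joint_le (μ : Measure Ω) [IsProbabilityMeasure μ] {S : ℕ → Ω → Ω}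
    (hS : ∀ n, MeasurePreserving (S n) μ μ) {f : Ω → α} (hf : Measurable f) {g : Ω → β}
    (hg : Measurable g) (n : ℕ) :
    ent μ (fun x => (joint S f n x, joint S g n x)) ≤
      ent μ (joint S g n) + n * (ent μ (fun x => (f x, g x)) - ent μ g) := by
  have mF := fun n => joint_meas (fun i => (hS i).measurable) hf n
  have mG := fun n => joint_meas (fun i => (hS i).measurable) hg n
  induction n with
  | zero =>
    have h := ent_comp_le μ (mG 0) ((mF 0).prodMk (mG 0)) ⟨fun a => (Fin.elim0, a), fun x => by
      ext i
      · exact i.elim0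
      · rfl⟩
    simpa using h
  | succ n ih =>
    have mf : Measurable (fun x => f (S n x)) := hf.comp (hS n).measurable
    have mg : Measurable (fun x => g (S n x)) := hg.comp (hS n).measurable
    have a1 := ent_submod μ mf ((mF n).prodMk (mG n)) mg
    have a2 := ent_submod μ (mF n) mg (mG n)
    have a3 := ent_mp μ (hS n) (hf.prodMk hg)
    have a4 := ent_mp μ (hS n) hg
    have b1 : ent μ (fun x => (joint S f (n+1) x, joint S g (n+1) x)) ≤
        ent μ (fun x => (f (S n x), (joint S f n x, joint S g n x), g (S n x))) := by
      refine ent_comp_le μ (mf.prodMk (((mF n).prodMk (mG n)).prodMk mg)) ((mF _).prodMk (mG _))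
        ⟨fun p => (Fin.snoc p.2.1.1 p.1, Fin.snoc p.2.1.2 p.2.2), fun x => ?_⟩
      ext i
      · refine Fin.lastCases ?_ (fun i => ?_) i <;> simp [joint]
      · refine Fin.lastCases ?_ (fun i => ?_) i <;> simp [joint]
    have b2 : ent μ (fun x => ((joint S f n x, joint S g n x), g (S n x))) ≤
        ent μ (fun x => (joint S f n x, g (S n x), joint S g n x)) :=
      ent_comp_le μ ((mF n).prodMk (mg.prodMk (mG n))) (((mF n).prodMk (mG n)).prodMk mg)
        ⟨fun p => ((p.1, p.2.2), p.2.1), fun x => rfl⟩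
    have b3 : ent μ (fun x => (g (S n x), joint S g n x)) ≤ ent μ (joint S g (n+1)) := by
      refine ent_comp_le μ (mG _) (mg.prodMk (mG n))
        ⟨fun p => (p (Fin.last n), fun i => p i.castSucc), fun x => rfl⟩
    push_cast
    linarith

theorem joint_le' (μ : Measure Ω) [IsProbabilityMeasure μ] {S : ℕ → Ω → Ω}
    (hS : ∀ n, MeasurePreserving (S n) μ μ) {f : Ω → α} (hf : Measurable f) {g : Ω → β}
    (hg : Measurable g) (n : ℕ) :
    ent μ (joint S f n) ≤
      ent μ (joint S g n) + n * (ent μ (fun x => (f x, g x)) - ent μ g) := by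
  have mF := fun n => joint_meas (fun i => (hS i).measurable) hf n
  have mG := fun n => joint_meas (fun i => (hS i).measurable) hg n
  refine le_trans ?_ (joint_le μ hS hf hg n)
  exact ent_comp_le μ (by fun_prop) (mF n) ⟨Prod.fst, fun _ => rfl⟩

theorem joint_bound (μ : Measure Ω) [IsProbabilityMeasure μ] {S : ℕ → Ω → Ω}
    (hS : ∀ n, MeasurePreserving (S n) μ μ) {f : Ω → α} (hf : Measurable f) (n : ℕ) :
    ent μ (joint S f n) ≤ n * ent μ f := by
  have hk : Measurable (fun _ : Ω => ()) := measurable_const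
  have h := joint_le' μ hS hf hk n
  rw [ent_const μ (joint S (fun _ : Ω => ()) n), ent_const μ (fun _ : Ω => ())] at h
  have h2 : ent μ (fun x => (f x, ())) ≤ ent μ f :=
    ent_comp_le μ hf (hf.prodMk hk) ⟨fun a => (a, ()), fun _ => rfl⟩
  have : (n:ℝ) * ent μ (fun x => (f x, ())) ≤ n * ent μ f := by gcongr
  linarith

theorem joint_comp_le (μ : Measure Ω) [IsProbabilityMeasure μ] {S : ℕ → Ω → Ω}
    (hS : ∀ n, MeasurePreserving (S n) μ μ) {f : Ω → α} (hf : Measurable f) {g : Ω → β}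
    (hg : Measurable g) (h : ∃ φ : β → α, ∀ᵐ x ∂μ, f x = φ (g x)) (n : ℕ) :
    ent μ (joint S f n) ≤ ent μ (joint S g n) := by
  obtain ⟨φ, hφ⟩ := h
  have mφ : Measurable φ := measurable_of_finite φ
  have e : joint S f n =ᵐ[μ] joint S (fun x => φ (g x)) n := by
    have : ∀ i : Fin n, ∀ᵐ x ∂μ, f (S i x) = φ (g (S i x)) := fun i =>
      (hS i).quasiMeasurePreserving.ae hφ
    filter_upwards [ae_all_iff.2 this] with x hx
    ext i; exact hx i
  rw [ent_congr μ e]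
  exact ent_comp_le μ (joint_meas (fun i => (hS i).measurable) hg n)
    (joint_meas (fun i => (hS i).measurable) (mφ.comp hg) n) ⟨fun p i => φ (p i), fun x => rfl⟩

/-- Entropy rate. -/
def rate {Ω : Type*} [MeasurableSpace Ω] {α : Type*} [Fintype α] (μ : Measure Ω)
    (S : ℕ → Ω → Ω) (f : Ω → α) : ℝ :=
  limsup (fun n : ℕ => ent μ (joint S f n) / n) atTop

theorem rate_bdd_above (μ : Measure Ω) [IsProbabilityMeasure μ] {S : ℕ → Ω → Ω}
    (hS : ∀ n, MeasurePreserving (S n) μ μ) {f : Ω → α} (hf : Measurable f) :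
    IsBoundedUnder (· ≤ ·) atTop (fun n : ℕ => ent μ (joint S f n) / n) := by
  refine ⟨ent μ f, ?_⟩
  rw [eventually_map]
  refine Eventually.of_forall fun n => ?_
  exact div_le_of_le_mul₀ (by positivity) (ent_nonneg _ _) (by rw [mul_comm]; exact joint_bound μ hS hf n)

theorem rate_bdd_below (μ : Measure Ω) [IsProbabilityMeasure μ] (S : ℕ → Ω → Ω)
    (f : Ω → α) :
    IsBoundedUnder (· ≥ ·) atTop (fun n : ℕ => ent μ (joint S f n) / n) := by
  refine ⟨0, ?_⟩
  rw [eventually_map]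
  exact Eventually.of_forall fun n => div_nonneg (ent_nonneg _ _) (by positivity)

theorem rate_nonneg (μ : Measure Ω) [IsProbabilityMeasure μ] {S : ℕ → Ω → Ω}
    (hS : ∀ n, MeasurePreserving (S n) μ μ) {f : Ω → α} (hf : Measurable f) : 0 ≤ rate μ S f := by
  refine le_limsup_of_frequently_le (Frequently.of_forall fun n => ?_) (rate_bdd_above μ hS hf)
  exact div_nonneg (ent_nonneg _ _) (by positivity)

theorem rate_mono (μ : Measure Ω) [IsProbabilityMeasure μ] {S : ℕ → Ω → Ω}
    (hS : ∀ n, MeasurePreserving (S n) μ μ) {f : Ω → α} (hf : Measurable f) {g : Ω → β}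
    (hg : Measurable g) (h : ∃ φ : β → α, ∀ᵐ x ∂μ, f x = φ (g x)) :
    rate μ S f ≤ rate μ S g := by
  refine limsup_le_limsup (Eventually.of_forall fun n => ?_)
    (rate_bdd_below μ S f).isCoboundedUnder_le (rate_bdd_above μ hS hg)
  dsimp only
  gcongr
  exact joint_comp_le μ hS hf hg h n

end Basic

section Rate

set_option linter.unusedSectionVars false

variable {Ω Ω' : Type*} [MeasurableSpace Ω] [MeasurableSpace Ω'] {α β γ : Type*}
  [Fintype α] [MeasurableSpace α] [MeasurableSingletonClass α]
  [Fintype β] [MeasurableSpace β] [MeasurableSingletonClass β]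

theorem limsup_add_aux {u v w : ℕ → ℝ} (h : ∀ᶠ n in atTop, u n ≤ v n + w n)
    (hu : IsBoundedUnder (· ≥ ·) atTop u)
    (hv : IsBoundedUnder (· ≤ ·) atTop v) (hw : IsBoundedUnder (· ≤ ·) atTop w) :
    limsup u atTop ≤ limsup v atTop + limsup w atTop := by
  refine le_of_forall_pos_le_add fun ε hε => ?_
  have h1 := eventually_lt_of_limsup_lt (lt_add_of_pos_right (limsup v atTop) (half_pos hε)) hv
  have h2 := eventually_lt_of_limsup_lt (lt_add_of_pos_right (limsup w atTop) (half_pos hε)) hw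
  refine limsup_le_of_le hu.isCoboundedUnder_le ?_
  filter_upwards [h, h1, h2] with n a b c
  linarith

theorem rate_approx (μ : Measure Ω) [IsProbabilityMeasure μ] {S : ℕ → Ω → Ω}
    (hS : ∀ n, MeasurePreserving (S n) μ μ) {f : Ω → α} (hf : Measurable f) {g : Ω → β}
    (hg : Measurable g) :
    rate μ S f ≤ rate μ S g + (ent μ (fun x => (f x, g x)) - ent μ g) := by
  have h := limsup_add_aux (u := fun n : ℕ => ent μ (joint S f n) / n)
    (v := fun n : ℕ => ent μ (joint S g n) / n)
    (w := fun _ => ent μ (fun x => (f x, g x)) - ent μ g) ?_ (rate_bdd_below μ S f)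
    (rate_bdd_above μ hS hg) isBoundedUnder_const
  · simpa only [limsup_const, rate] using h
  · filter_upwards [eventually_gt_atTop 0] with n hn
    have hn' : (0:ℝ) < n := by exact_mod_cast hn
    rw [div_add' _ _ _ hn'.ne']
    gcongr
    rw [mul_comm]
    exact joint_le' μ hS hf hg n

theorem rate_prod (μ : Measure Ω) [IsProbabilityMeasure μ] (ν : Measure Ω') [IsProbabilityMeasure ν]
    {S : ℕ → Ω → Ω} {S' : ℕ → Ω' → Ω'}
    (hS : ∀ n, MeasurePreserving (S n) μ μ) (hS' : ∀ n, MeasurePreserving (S' n) ν ν)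
    {f : Ω → α} (hf : Measurable f) {g : Ω' → β} (hg : Measurable g) :
    rate (μ.prod ν) (fun n => Prod.map (S n) (S' n)) (fun p => (f p.1, g p.2)) ≤
      rate μ S f + rate ν S' g := by
  refine limsup_add_aux (Eventually.of_forall fun n => ?_) (rate_bdd_below _ _ _)
    (rate_bdd_above μ hS hf) (rate_bdd_above ν hS' hg)
  rw [← add_div]
  gcongr
  have mF := joint_meas (fun i => (hS i).measurable) hf n
  have mG := joint_meas (fun i => (hS' i).measurable) hg n
  rw [← ent_mp (μ.prod ν) measurePreserving_fst mF, ← ent_mp (μ.prod ν) measurePreserving_snd mG]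
  refine le_trans ?_ (ent_pair_le (μ.prod ν) (mF.comp measurable_fst) (mG.comp measurable_snd))
  refine ent_comp_le _ ((mF.comp measurable_fst).prodMk (mG.comp measurable_snd)) ?_
    ⟨fun p i => (p.1 i, p.2 i), fun x => rfl⟩
  exact joint_meas (fun i => ((hS i).prod (hS' i)).measurable)
    ((hf.comp measurable_fst).prodMk (hg.comp measurable_snd)) n

theorem ent_pi_le (μ : Measure Ω) [IsProbabilityMeasure μ] (k : ℕ) (e : Fin k → Ω → α)
    (he : ∀ i, Measurable (e i)) : ent μ (fun x i => e i x) ≤ ∑ i, ent μ (e i) := by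
  induction k with
  | zero => rw [ent_const]; simp
  | succ k ih =>
    rw [Fin.sum_univ_succ]
    have m2 : Measurable (fun x (i : Fin k) => e i.succ x) := measurable_pi_lambda _ fun i => he _
    have h1 := ih (fun i => e i.succ) (fun i => he _)
    have h2 := ent_pair_le μ (he 0) m2
    have h3 : ent μ (fun x i => e i x) ≤ ent μ (fun x => (e 0 x, fun i : Fin k => e i.succ x)) := by
      refine ent_comp_le μ ((he 0).prodMk m2) (measurable_pi_lambda _ fun i => he _)
        ⟨fun p => Fin.cons p.1 p.2, fun x => ?_⟩
      ext i
      refine Fin.cases ?_ (fun i => ?_) i <;> simp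
    linarith

/-- The algebra of finite unions of measurable rectangles. -/
def rectAlg (Ω Ω' : Type*) [MeasurableSpace Ω] [MeasurableSpace Ω'] : Set (Set (Ω × Ω')) :=
  {R | ∃ (l m : ℕ) (g : Ω → Fin l) (g' : Ω' → Fin m) (Q : Set (Fin l × Fin m)),
    Measurable g ∧ Measurable g' ∧ R = (fun p : Ω × Ω' => (g p.1, g' p.2)) ⁻¹' Q}

theorem rectAlg_isSetAlgebra : IsSetAlgebra (rectAlg Ω Ω') where
  empty_mem := ⟨1, 1, fun _ => 0, fun _ => 0, ∅, measurable_const, measurable_const, by simp⟩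
  compl_mem := by
    rintro _ ⟨l, m, g, g', Q, hg, hg', rfl⟩
    exact ⟨l, m, g, g', Qᶜ, hg, hg', rfl⟩
  union_mem := by
    rintro _ _ ⟨l, m, g, g', Q, hg, hg', rfl⟩ ⟨l₂, m₂, g₂, g₂', Q₂, hg₂, hg₂', rfl⟩
    refine ⟨l * l₂, m * m₂, fun x => finProdFinEquiv (g x, g₂ x), fun x => finProdFinEquiv (g' x, g₂' x),
      {q | ((finProdFinEquiv.symm q.1).1, (finProdFinEquiv.symm q.2).1) ∈ Q ∨
        ((finProdFinEquiv.symm q.1).2, (finProdFinEquiv.symm q.2).2) ∈ Q₂},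
      (measurable_of_finite _).comp (hg.prodMk hg₂), (measurable_of_finite _).comp (hg'.prodMk hg₂'), ?_⟩
    ext p
    simp only [mem_union, mem_preimage, mem_setOf_eq, Equiv.symm_apply_apply]

theorem rectAlg_generate :
    (Prod.instMeasurableSpace : MeasurableSpace (Ω × Ω')) = MeasurableSpace.generateFrom (rectAlg Ω Ω') := by
  classical
  apply le_antisymm
  · rw [← generateFrom_prod]
    refine MeasurableSpace.generateFrom_mono ?_
    rintro _ ⟨s, hs, t, ht, rfl⟩
    refine ⟨2, 2, fun x => if x ∈ s then 1 else 0, fun x => if x ∈ t then 1 else 0, {(1, 1)},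
      Measurable.ite hs measurable_const measurable_const,
      Measurable.ite ht measurable_const measurable_const, ?_⟩
    ext p
    simp [Prod.ext_iff]
  · refine MeasurableSpace.generateFrom_le ?_
    rintro _ ⟨l, m, g, g', Q, hg, hg', rfl⟩
    exact ((hg.comp measurable_fst).prodMk (hg'.comp measurable_snd)) (Set.toFinite Q).measurableSet

theorem ent_bool_small {ε : ℝ} (hε : 0 < ε) : ∃ δ > 0, ∀ (μ : Measure Ω) [IsProbabilityMeasure μ]
    (e : Ω → Bool) (_ : Measurable e), μ.real (e ⁻¹' {true}) < δ → ent μ e < ε := by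
  have hc : Continuous fun p : ℝ => negMulLog p + negMulLog (1 - p) := by fun_prop
  obtain ⟨δ, hδ, h⟩ := Metric.continuous_iff.1 hc 0 ε hε
  refine ⟨δ, hδ, fun μ _ e he hp => ?_⟩
  have h1 := h (μ.real (e ⁻¹' {true})) (by simpa [Real.dist_eq, abs_of_nonneg measureReal_nonneg] using hp)
  have h2 := sum_real_univ μ he
  rw [Fintype.sum_bool] at h2
  simp only [negMulLog_zero, sub_zero, negMulLog_one, add_zero, Real.dist_eq] at h1
  unfold ent
  rw [Fintype.sum_bool, eq_sub_of_add_eq' h2]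
  exact (le_abs_self _).trans_lt h1

theorem exists_approx (μ : Measure Ω) [IsProbabilityMeasure μ] (ν : Measure Ω') [IsProbabilityMeasure ν]
    {k : ℕ} {f : Ω × Ω' → Fin k} (hf : Measurable f) {ε : ℝ} (hε : 0 < ε) :
    ∃ (l m : Fin k → ℕ) (g : Ω → (∀ i, Fin (l i))) (g' : Ω' → (∀ i, Fin (m i))),
      Measurable g ∧ Measurable g' ∧
      ent (μ.prod ν) (fun p => (f p, (g p.1, g' p.2))) ≤
        ent (μ.prod ν) (fun p => (g p.1, g' p.2)) + ε := by
  classical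
  have hne : Nonempty (Ω × Ω') := (μ.prod ν).nonempty_of_neZero
  have hk : Nonempty (Fin k) := hne.map f
  have hk0 : (0:ℝ) < k := by exact_mod_cast Fin.pos_iff_nonempty.2 hk
  obtain ⟨δ, hδ, hsmall⟩ := ent_bool_small (Ω := Ω × Ω') (div_pos hε hk0)
  have hd := Measure.MeasureDense.of_generateFrom_isSetAlgebra_finite (μ := μ.prod ν)
    (rectAlg_isSetAlgebra (Ω := Ω) (Ω' := Ω')) rectAlg_generate
  have h1 : ∀ i : Fin k, ∃ R ∈ rectAlg Ω Ω',
      (μ.prod ν) (symmDiff (f ⁻¹' {i}) R) < ENNReal.ofReal δ := fun i =>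
    hd.approx _ (hf (measurableSet_singleton i)) (measure_ne_top _ _) δ hδ
  choose R hR hRd using h1
  have mR : ∀ i, MeasurableSet (R i) := fun i => hd.measurable _ (hR i)
  choose l m g g' Q hg hg' hQ using hR
  have mg : Measurable (fun x i => g i x) := measurable_pi_lambda _ hg
  have mg' : Measurable (fun x i => g' i x) := measurable_pi_lambda _ hg'
  refine ⟨l, m, fun x i => g i x, fun x i => g' i x, mg, mg', ?_⟩
  set D : Fin k → Set (Ω × Ω') := fun i => symmDiff (f ⁻¹' {i}) (R i) with hD
  have mD : ∀ i, MeasurableSet (D i) := fun i => (hf (measurableSet_singleton i)).symmDiff (mR i)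
  set e : Fin k → Ω × Ω' → Bool := fun i p => decide (p ∈ D i) with he
  have me : ∀ i, Measurable (e i) := by
    intro i
    have : e i = fun p => if p ∈ D i then true else false := by
      ext p; by_cases h : p ∈ D i <;> simp [he, h]
    rw [this]
    exact Measurable.ite (mD i) measurable_const measurable_const
  have hei : ∀ i, ent (μ.prod ν) (e i) ≤ ε / k := by
    intro i
    refine (hsmall _ (e i) (me i) ?_).le
    have : e i ⁻¹' {true} = D i := by ext p; simp [he]
    rw [this]
    exact (ENNReal.lt_ofReal_iff_toReal_lt (measure_ne_top _ _)).1 (hRd i)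
  have hE := ent_pi_le (μ.prod ν) k e me
  have hE2 : ∑ i, ent (μ.prod ν) (e i) ≤ ε := by
    refine (Finset.sum_le_sum fun i _ => hei i).trans ?_
    simp only [Finset.sum_const, Finset.card_univ, Fintype.card_fin, nsmul_eq_mul]
    rw [mul_div_cancel₀ _ hk0.ne']
  have mE : Measurable (fun p i => e i p) := measurable_pi_lambda _ me
  have mG : Measurable (fun p : Ω × Ω' => ((fun i => g i p.1), (fun i => g' i p.2))) :=
    (mg.comp measurable_fst).prodMk (mg'.comp measurable_snd)
  have h3 := ent_pair_le (μ.prod ν) mE mG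
  have h4 : ent (μ.prod ν) (fun p => (f p, ((fun i => g i p.1), (fun i => g' i p.2)))) ≤
      ent (μ.prod ν) (fun p => ((fun i => e i p), ((fun i => g i p.1), (fun i => g' i p.2)))) := by
    refine ent_comp_le _ (mE.prodMk mG) (hf.prodMk mG) ?_
    have hne2 : Nonempty (Fin k × ((∀ i, Fin (l i)) × (∀ i, Fin (m i)))) :=
      hne.map fun p => (f p, ((fun i => g i p.1), (fun i => g' i p.2)))
    have key : Function.FactorsThrough
        (fun p : Ω × Ω' => (f p, ((fun i => g i p.1), (fun i => g' i p.2))))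
        (fun p => ((fun i => e i p), ((fun i => g i p.1), (fun i => g' i p.2)))) := by
      intro p q hpq
      simp only [Prod.mk.injEq] at hpq ⊢
      obtain ⟨hp1, hp2, hp3⟩ := hpq
      refine ⟨?_, hp2, hp3⟩
      have a1 := congrFun hp1 (f p)
      have a2 := congrFun hp2 (f p)
      have a3 := congrFun hp3 (f p)
      have a4 : p ∈ R (f p) ↔ q ∈ R (f p) := by
        rw [hQ (f p)]
        simp only [mem_preimage, a2, a3]
      simp only [he, hD, decide_eq_decide, mem_symmDiff, mem_preimage, mem_singleton_iff, a4] at a1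
      by_contra hcon
      have hcon' : ¬ f q = f p := fun h => hcon h.symm
      tauto
    obtain ⟨φ, hφ⟩ := (Function.factorsThrough_iff _).1 key
    exact ⟨φ, fun x => congrFun hφ x⟩
  linarith

end Rate

section Part

set_option linter.unusedSectionVars false

variable {α : Type*} [Fintype α] [MeasurableSpace α] [MeasurableSingletonClass α]

theorem exists_fun (μ : Measure X) [IsProbabilityMeasure μ] {ξ : Finset (Set X)}
    (hξ : IsPartition μ ξ) : ∃ (k : ℕ) (C : Fin k → Set X) (f : X → Fin k), Measurable f ∧
      (∀ B, B ∈ ξ ↔ ∃ i, C i = B) ∧ ∀ᵐ x ∂μ, ∀ i, x ∈ C i ↔ f x = i := by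
  classical
  obtain ⟨hm, hd, hcov⟩ := hξ
  set e := ξ.equivFin.symm
  set k := ξ.card
  have hk : 0 < k := by
    rw [Finset.card_pos, Finset.nonempty_iff_ne_empty]
    rintro rfl
    simp at hcov
  set C : Fin k → Set X := fun i => (e i : Set X) with hC
  have mC : ∀ i, MeasurableSet (C i) := fun i => hm _ (e i).2
  have hp : ∀ x, ∃ n : ℕ, ∀ h : n < k, x ∈ C ⟨n, h⟩ := fun x => ⟨k, fun h => absurd h (lt_irrefl _)⟩
  refine ⟨k, C, fun x => (fun n (_ : X) => if h : n < k then (⟨n, h⟩ : Fin k) else ⟨0, hk⟩)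
    (Nat.find (hp x)) x, ?_, ?_, ?_⟩
  · refine Measurable.find (f := fun n (_ : X) => if h : n < k then (⟨n, h⟩ : Fin k) else ⟨0, hk⟩)
      (fun n => measurable_const) (fun n => ?_) hp
    by_cases h : n < k
    · convert mC ⟨n, h⟩ using 1
      ext x; simp [h]
    · convert MeasurableSet.univ using 1
      ext x; simp [h]
  · intro B
    constructor
    · intro hB
      exact ⟨e.symm ⟨B, hB⟩, by simp [hC]⟩
    · rintro ⟨i, rfl⟩
      exact (e i).2
  · have h1 : ∀ᵐ x ∂μ, ∃ i, x ∈ C i := by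
      have : ∀ᵐ x ∂μ, x ∈ ⋃ B ∈ ξ, B := hcov
      filter_upwards [this] with x hx
      simp only [mem_iUnion] at hx
      obtain ⟨B, hB, hx⟩ := hx
      exact ⟨e.symm ⟨B, hB⟩, by simpa [hC] using hx⟩
    have h2 : ∀ᵐ x ∂μ, ∀ i j, i ≠ j → ¬ (x ∈ C i ∧ x ∈ C j) := by
      rw [ae_all_iff]; intro i
      rw [ae_all_iff]; intro j
      by_cases hij : i = j
      · simp [hij]
      · have : μ (C i ∩ C j) = 0 := hd _ (e i).2 _ (e j).2 (fun h => hij (e.injective (Subtype.ext h)))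
        filter_upwards [measure_eq_zero_iff_ae_notMem.1 this] with x hx _ using hx
    filter_upwards [h1, h2] with x ⟨i0, hx0⟩ hx i
    have hlt : Nat.find (hp x) < k := by
      refine lt_of_le_of_lt (Nat.find_min' (hp x) (m := i0) fun h => ?_) i0.2
      simpa using hx0
    have hmem := Nat.find_spec (hp x) hlt
    simp only [hlt, dif_pos]
    constructor
    · intro hi
      by_contra hne
      exact hx _ _ hne ⟨hmem, hi⟩
    · rintro rfl
      exact hmem

theorem partEntropy_eq (μ : Measure X) [IsProbabilityMeasure μ] (T : Equiv.Perm X)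
    (hT : ∀ t : ℤ, MeasurePreserving ⇑(T ^ t) μ μ) (A : ℕ → ℤ) {ξ : Finset (Set X)}
    {k : ℕ} {C : Fin k → Set X} {f : X → Fin k}
    (hC : ∀ B, B ∈ ξ ↔ ∃ i, C i = B) (hCf : ∀ᵐ x ∂μ, ∀ i, x ∈ C i ↔ f x = i) (n : ℕ) :
    partEntropy μ (seqPart μ T A ξ n) = ent μ (joint (fun n => ⇑(T ^ A n)) f n) := by
  classical
  set S : ℕ → X → X := fun n => ⇑(T ^ A n) with hS
  set B : (Fin n → Fin k) → Set X := fun d => ⋂ i : Fin n, S i ⁻¹' C (d i) with hB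
  have hBJ : ∀ d, B d =ᵐ[μ] joint S f n ⁻¹' {d} := by
    intro d
    have : ∀ᵐ x ∂μ, ∀ i : Fin n, ∀ j, S i x ∈ C j ↔ f (S i x) = j := by
      rw [ae_all_iff]; intro i
      exact (hT (A i)).quasiMeasurePreserving.ae hCf
    filter_upwards [this] with x hx
    change (x ∈ B d) = (joint S f n x = d)
    simp only [hB, mem_iInter, mem_preimage, hx, funext_iff, joint]
  have hseq : seqPart μ T A ξ n = (Finset.univ.filter fun d => μ (B d) ≠ 0).image B := by
    unfold seqPart
    ext E
    simp only [Finset.mem_filter, Finset.mem_image, Fintype.mem_piFinset, Finset.mem_univ, true_and]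
    constructor
    · rintro ⟨⟨c, hc, rfl⟩, h0⟩
      choose d hd using fun i => (hC _).1 (hc i)
      have : B d = ⋂ i : Fin n, ⇑(T ^ A (i : ℕ)) ⁻¹' c i := by
        simp only [hB, hd, hS]
      exact ⟨d, by rwa [this], this⟩
    · rintro ⟨d, h0, rfl⟩
      exact ⟨⟨fun i => C (d i), fun i => (hC _).2 ⟨_, rfl⟩, rfl⟩, h0⟩
  unfold partEntropy ent
  rw [hseq, Finset.sum_image]
  · rw [Finset.sum_filter_of_ne, ← Finset.sum_neg_distrib]
    · refine Finset.sum_congr rfl fun d _ => ?_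
      rw [measure_congr (hBJ d), negMulLog_eq_neg]
      rfl
    · intro d _ h h0
      simp [h0] at h
  · intro d hd d' hd' hdd
    by_contra hne
    have h1 : joint S f n ⁻¹' {d} =ᵐ[μ] joint S f n ⁻¹' {d'} :=
      (hBJ d).symm.trans ((Filter.EventuallyEq.of_eq hdd).trans (hBJ d'))
    have h2 : ∀ᵐ x ∂μ, x ∉ joint S f n ⁻¹' {d} := by
      filter_upwards [h1] with x hx hx1
      have hx2 : x ∈ joint S f n ⁻¹' {d'} := by
        have : (x ∈ joint S f n ⁻¹' {d}) = (x ∈ joint S f n ⁻¹' {d'}) := hx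
        rwa [← this]
      exact hne (hx1.symm.trans hx2)
    have h3 := measure_eq_zero_iff_ae_notMem.2 h2
    rw [← measure_congr (hBJ d)] at h3
    have : μ (B d) ≠ 0 := by simpa using hd
    exact this h3

theorem seqEntPart_eq (μ : Measure X) [IsProbabilityMeasure μ] (T : Equiv.Perm X)
    (hT : ∀ t : ℤ, MeasurePreserving ⇑(T ^ t) μ μ) (A : ℕ → ℤ) {ξ : Finset (Set X)}
    {k : ℕ} {C : Fin k → Set X} {f : X → Fin k}
    (hC : ∀ B, B ∈ ξ ↔ ∃ i, C i = B) (hCf : ∀ᵐ x ∂μ, ∀ i, x ∈ C i ↔ f x = i) :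
    seqEntPart μ T A ξ = rate μ (fun n => ⇑(T ^ A n)) f := by
  unfold seqEntPart rate
  simp only [partEntropy_eq μ T hT A hC hCf]

theorem exists_rate_eq (μ : Measure X) [IsProbabilityMeasure μ] (T : Equiv.Perm X)
    (hT : ∀ t : ℤ, MeasurePreserving ⇑(T ^ t) μ μ) (A : ℕ → ℤ) {ξ : Finset (Set X)}
    (hξ : IsPartition μ ξ) : ∃ (k : ℕ) (f : X → Fin k), Measurable f ∧
      seqEntPart μ T A ξ = rate μ (fun n => ⇑(T ^ A n)) f := by
  obtain ⟨k, C, f, hf, hC, hCf⟩ := exists_fun μ hξ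
  exact ⟨k, f, hf, seqEntPart_eq μ T hT A hC hCf⟩

theorem exists_part_ge (μ : Measure X) [IsProbabilityMeasure μ] (T : Equiv.Perm X)
    (hT : ∀ t : ℤ, MeasurePreserving ⇑(T ^ t) μ μ) (A : ℕ → ℤ) {f : X → α} (hf : Measurable f) :
    ∃ ξ : Finset (Set X), IsPartition μ ξ ∧
      rate μ (fun n => ⇑(T ^ A n)) f ≤ seqEntPart μ T A ξ := by
  classical
  set ξ : Finset (Set X) := Finset.univ.image fun i : α => f ⁻¹' {i} with hξd
  have hξ : IsPartition μ ξ := by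
    refine ⟨?_, ?_, ?_⟩
    · intro D hD
      obtain ⟨i, -, rfl⟩ := Finset.mem_image.1 hD
      exact hf (measurableSet_singleton i)
    · intro D hD E hE hne
      obtain ⟨i, -, rfl⟩ := Finset.mem_image.1 hD
      obtain ⟨j, -, rfl⟩ := Finset.mem_image.1 hE
      have : f ⁻¹' {i} ∩ f ⁻¹' {j} = ∅ := by
        ext x
        simp only [mem_inter_iff, mem_preimage, mem_singleton_iff, mem_empty_iff_false, iff_false]
        rintro ⟨rfl, rfl⟩
        exact hne rfl
      rw [this, measure_empty]
    · have : (⋃ D ∈ ξ, D) = univ := by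
        ext x
        simp [hξd]
      rw [this]; simp
  refine ⟨ξ, hξ, ?_⟩
  obtain ⟨k, C, g, hg, hC, hCf⟩ := exists_fun μ hξ
  rw [seqEntPart_eq μ T hT A hC hCf]
  have h1 : ∀ i, ∃ a, f ⁻¹' {a} = C i := fun i => by
    obtain ⟨a, -, ha⟩ := Finset.mem_image.1 ((hC (C i)).2 ⟨i, rfl⟩)
    exact ⟨a, ha⟩
  choose φ hφ using h1
  refine rate_mono μ (fun n => hT (A n)) hf hg ⟨φ, ?_⟩
  filter_upwards [hCf] with x hx
  have := (hx (g x)).2 rfl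
  rw [← hφ] at this
  exact this

theorem seqEnt_nonneg (μ : Measure X) [IsProbabilityMeasure μ] (T : Equiv.Perm X)
    (hT : ∀ t : ℤ, MeasurePreserving ⇑(T ^ t) μ μ) (A : ℕ → ℤ) : 0 ≤ seqEnt μ T A := by
  refine Real.sSup_nonneg ?_
  rintro _ ⟨ξ, hξ, rfl⟩
  obtain ⟨k, f, hf, h⟩ := exists_rate_eq μ T hT A hξ
  rw [h]
  exact rate_nonneg μ (fun n => hT _) hf

theorem rate_le_seqEnt (μ : Measure X) [IsProbabilityMeasure μ] (T : Equiv.Perm X)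
    (hT : ∀ t : ℤ, MeasurePreserving ⇑(T ^ t) μ μ) (A : ℕ → ℤ)
    (hb : BddAbove {h | ∃ ξ : Finset (Set X), IsPartition μ ξ ∧ seqEntPart μ T A ξ = h})
    {f : X → α} (hf : Measurable f) :
    rate μ (fun n => ⇑(T ^ A n)) f ≤ seqEnt μ T A := by
  obtain ⟨ξ, hξ, h⟩ := exists_part_ge μ T hT A hf
  exact h.trans (le_csSup hb ⟨ξ, hξ, rfl⟩)

/-- Boundedness passes to a factor. -/
theorem bdd_factor {Y : Type*} [MeasurableSpace Y] (μ : Measure X) [IsProbabilityMeasure μ]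
    (ν : Measure Y) [IsProbabilityMeasure ν] (T : Equiv.Perm X) (R : Equiv.Perm Y)
    (hT : ∀ t : ℤ, MeasurePreserving ⇑(T ^ t) μ μ) (hR : ∀ t : ℤ, MeasurePreserving ⇑(R ^ t) ν ν)
    (A : ℕ → ℤ) {prj : Y → X} (hprj : MeasurePreserving prj ν μ)
    (hprjR : ∀ (t : ℤ) y, prj ((R ^ t) y) = (T ^ t) (prj y))
    (hb : BddAbove {h | ∃ ξ : Finset (Set Y), IsPartition ν ξ ∧ seqEntPart ν R A ξ = h}) :
    BddAbove {h | ∃ ξ : Finset (Set X), IsPartition μ ξ ∧ seqEntPart μ T A ξ = h} := by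
  refine ⟨seqEnt ν R A, ?_⟩
  rintro _ ⟨ξ, hξ, rfl⟩
  obtain ⟨k, f, hf, h⟩ := exists_rate_eq μ T hT A hξ
  rw [h]
  refine le_trans (le_of_eq ?_) (rate_le_seqEnt ν R hR A hb (hf.comp hprj.measurable))
  unfold rate
  congr 1
  ext n
  congr 1
  rw [← ent_mp ν hprj (joint_meas (fun i => (hT _).measurable) hf n)]
  congr 1
  ext y i
  simp [joint, hprjR]

theorem prod_zpow {Y : Type*} (T : Equiv.Perm X) (T' : Equiv.Perm Y) (t : ℤ) :
    ⇑((Equiv.prodCongr T T' : Equiv.Perm (X × Y)) ^ t) = Prod.map ⇑(T ^ t) ⇑(T' ^ t) := by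
  let F : Equiv.Perm X × Equiv.Perm Y →* Equiv.Perm (X × Y) :=
    { toFun := fun p => Equiv.prodCongr p.1 p.2
      map_one' := by ext x <;> rfl
      map_mul' := fun p q => by ext x <;> rfl }
  have h := map_zpow F (T, T') t
  have h2 : (Equiv.prodCongr T T' : Equiv.Perm (X × Y)) ^ t = Equiv.prodCongr (T ^ t) (T' ^ t) := h.symm
  rw [h2]
  rfl

end Part

end SeqEntAux

/-- Subadditivity of sequence entropy under products:
`h_{A,μ×μ'}(T×T') ≤ h_{A,μ}(T) + h_{A,μ'}(T')`. -/
theorem seqEnt_product_subadditive {Y : Type*} [MeasurableSpace Y]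
    (μ : Measure X) (μ' : Measure Y) [IsProbabilityMeasure μ] [IsProbabilityMeasure μ']
    (T : Equiv.Perm X) (T' : Equiv.Perm Y)
    (hT : ∀ t : ℤ, MeasurePreserving ⇑(T ^ t) μ μ)
    (hT' : ∀ t : ℤ, MeasurePreserving ⇑(T' ^ t) μ' μ')
    (A : ℕ → ℤ) :
    seqEnt (μ.prod μ') (Equiv.prodCongr T T') A ≤ seqEnt μ T A + seqEnt μ' T' A := by
  have hP : ∀ t : ℤ, MeasurePreserving ⇑((Equiv.prodCongr T T' : Equiv.Perm (X × Y)) ^ t)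
      (μ.prod μ') (μ.prod μ') := fun t => by
    rw [SeqEntAux.prod_zpow]; exact (hT t).prod (hT' t)
  have hS : (fun n => ⇑((Equiv.prodCongr T T' : Equiv.Perm (X × Y)) ^ A n)) =
      fun n => Prod.map ⇑(T ^ A n) ⇑(T' ^ A n) := by
    funext n; rw [SeqEntAux.prod_zpow]
  by_cases hb : BddAbove {h | ∃ ξ : Finset (Set (X × Y)), IsPartition (μ.prod μ') ξ ∧
      seqEntPart (μ.prod μ') (Equiv.prodCongr T T') A ξ = h}
  · have b1 := SeqEntAux.bdd_factor μ (μ.prod μ') T (Equiv.prodCongr T T') hT hP A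
      measurePreserving_fst (fun t y => by rw [SeqEntAux.prod_zpow]; rfl) hb
    have b2 := SeqEntAux.bdd_factor μ' (μ.prod μ') T' (Equiv.prodCongr T T') hT' hP A
      measurePreserving_snd (fun t y => by rw [SeqEntAux.prod_zpow]; rfl) hb
    refine Real.sSup_le ?_ (add_nonneg (SeqEntAux.seqEnt_nonneg μ T hT A)
      (SeqEntAux.seqEnt_nonneg μ' T' hT' A))
    rintro _ ⟨ξ, hξ, rfl⟩
    obtain ⟨k, f, hf, h⟩ := SeqEntAux.exists_rate_eq (μ.prod μ') (Equiv.prodCongr T T') hP A hξ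
    rw [h]
    refine le_of_forall_pos_le_add fun ε hε => ?_
    obtain ⟨l, m, g, g', hg, hg', hle⟩ := SeqEntAux.exists_approx μ μ' hf hε
    have c1 := SeqEntAux.rate_approx (μ.prod μ') (fun n => hP (A n)) hf
      ((hg.comp measurable_fst).prodMk (hg'.comp measurable_snd))
    have c2 := SeqEntAux.rate_prod μ μ' (fun n => hT (A n)) (fun n => hT' (A n)) hg hg'
    have c3 := SeqEntAux.rate_le_seqEnt μ T hT A b1 hg
    have c4 := SeqEntAux.rate_le_seqEnt μ' T' hT' A b2 hg'
    rw [← hS] at c2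
    simp only [Function.comp_def] at c1
    linarith
  · unfold seqEnt
    rw [Real.sSup_of_not_bddAbove hb]
    exact add_nonneg (SeqEntAux.seqEnt_nonneg μ T hT A) (SeqEntAux.seqEnt_nonneg μ' T' hT' A)

end
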